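/- arXiv:0910.3640 — 2 statements merged into one kernel-verified Lean document; each statement's English description precedes it below -/
import Mathlib

section
/- Let b : ℝ³ × S² → [0,∞) be measurable with b ∈ L¹(ℝ³ × S²), and let f₀ ∈ L^∞(ℝ³ × ℝ³) with 0 ≤ f₀ ≤ 1 a.e. Then there exists a unique (up to a.e. equality) measurable function f : [0,∞) × ℝ³ × ℝ³ → ℝ with f ∈ L^∞([0,∞) × ℝ³ × ℝ³) and 0 ≤ f ≤ 1 a.e. which is a mild solution of the Boltzmann–Fermi–Dirac equation with initial datum f₀, i.e. for a.e. (x,v) ∈ ℝ³ × ℝ³ and all t ≥ 0, f(t, x + t v, v) = f₀(x, v) + ∫₀ᵗ Q(f(s, x + s v, ·))(v) ds. Moreover, for a.e. (x,v) the map t ↦ f(t, x + t v, v) is absolutely continuous. -/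
open MeasureTheory Metric
open scoped RealInnerProductSpace ENNReal

noncomputable section

/-- Euclidean space `ℝ³`. -/
abbrev R3 : Type := EuclideanSpace ℝ (Fin 3)

/-- The unit sphere `S² ⊂ ℝ³`. -/
abbrev S2 : Type := sphere (0 : R3) 1

/-- The surface measure on the unit sphere `S²`. -/
def sphMeasure : Measure S2 := (volume : Measure R3).toSphere

/-- The precollisional velocity `v' = v - ((v - v*)·ω) ω`. -/
def vPrime (v vs : R3) (ω : S2) : R3 := v - ⟪v - vs, (ω : R3)⟫ • (ω : R3)

/-- The precollisional velocity `v*' = v* + ((v - v*)·ω) ω`. -/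
def vsPrime (v vs : R3) (ω : S2) : R3 := vs + ⟪v - vs, (ω : R3)⟫ • (ω : R3)

/-- The Boltzmann–Fermi–Dirac collision operator with collision kernel `b`:
`Q(f)(v) = ∫_{S²} ∫_{ℝ³} b(v - v*, ω) [f' f*' (1-f)(1-f*) - f f* (1-f')(1-f*')] dv* dω`. -/
def Qcoll (b : R3 × S2 → ℝ) (f : R3 → ℝ) (v : R3) : ℝ :=
  ∫ ω : S2, ∫ vs : R3,
      b (v - vs, ω) *
        (f (vPrime v vs ω) * f (vsPrime v vs ω) * (1 - f v) * (1 - f vs)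
          - f v * f vs * (1 - f (vPrime v vs ω)) * (1 - f (vsPrime v vs ω)))
    ∂(volume : Measure R3) ∂sphMeasure
/-- `F` is absolutely continuous on the set `s ⊆ ℝ`: for every `ε > 0` there is `δ > 0`
such that for every finite family of non-overlapping intervals with endpoints in `s` and
total length `< δ`, the total variation of `F` over them is `< ε`. -/
def AbsContOn (F : ℝ → ℝ) (s : Set ℝ) : Prop :=
  ∀ ε > (0 : ℝ), ∃ δ > (0 : ℝ), ∀ n : ℕ, ∀ a c : Fin n → ℝ,
    (∀ i, a i ∈ s ∧ c i ∈ s ∧ a i ≤ c i) →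
    (Pairwise fun i j => Disjoint (Set.Ioo (a i) (c i)) (Set.Ioo (a j) (c j))) →
    (∑ i, (c i - a i)) < δ → (∑ i, |F (c i) - F (a i)|) < ε

/-- `f` is a mild solution of the Boltzmann–Fermi–Dirac equation with initial datum `f₀`:
for a.e. `(x,v)` and all `t ≥ 0`,
`f(t, x + t v, v) = f₀(x,v) + ∫₀ᵗ Q(f(s, x + s v, ·))(v) ds`. -/
def IsMildSolution (b : R3 × S2 → ℝ) (f₀ : R3 × R3 → ℝ) (f : ℝ × R3 × R3 → ℝ) : Prop :=
  ∀ᵐ q : R3 × R3 ∂(volume : Measure (R3 × R3)), ∀ t : ℝ, 0 ≤ t →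
    f (t, q.1 + t • q.2, q.2) =
      f₀ q + ∫ s in (0 : ℝ)..t, Qcoll b (fun w => f (s, q.1 + s • q.2, w)) q.2

instance : IsFiniteMeasure sphMeasure := by unfold sphMeasure; infer_instance

/-- The collision map as a linear map on `ℝ³ × ℝ³`. -/
def collLin (ω : S2) : (R3 × R3) →ₗ[ℝ] (R3 × R3) where
  toFun p := (vPrime p.1 p.2 ω, vsPrime p.1 p.2 ω)
  map_add' p q := by
    ext1
    · simp only [vPrime, Prod.fst_add, Prod.snd_add, add_sub_add_comm, inner_add_left, add_smul]
    · simp only [vsPrime, Prod.fst_add, Prod.snd_add, add_sub_add_comm, inner_add_left, add_smul]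
      abel
  map_smul' c p := by
    ext1
    · simp only [vPrime, Prod.smul_fst, Prod.smul_snd, ← smul_sub, inner_smul_left, mul_smul,
        RingHom.id_apply]
      simp [smul_sub]
    · simp only [vsPrime, Prod.smul_fst, Prod.smul_snd, ← smul_sub, inner_smul_left, mul_smul,
        RingHom.id_apply]
      simp

lemma collLin_invol (ω : S2) (p : R3 × R3) : collLin ω (collLin ω p) = p := by
  have hω : ⟪(ω : R3), (ω : R3)⟫ = 1 := by
    rw [real_inner_self_eq_norm_sq]; simp
  have h : ⟪vPrime p.1 p.2 ω - vsPrime p.1 p.2 ω, (ω : R3)⟫ = - ⟪p.1 - p.2, (ω : R3)⟫ := by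
    simp only [vPrime, vsPrime, inner_sub_left, inner_add_left, inner_smul_left, hω]
    simp
  ext1
  · change vPrime (vPrime p.1 p.2 ω) (vsPrime p.1 p.2 ω) ω = _
    rw [vPrime, h]; simp [vPrime]
  · change vsPrime (vPrime p.1 p.2 ω) (vsPrime p.1 p.2 ω) ω = _
    rw [vsPrime, h]; simp [vsPrime]

lemma collLin_det (ω : S2) : LinearMap.det (collLin ω) ≠ 0 := by
  have : LinearMap.det (collLin ω) * LinearMap.det (collLin ω) = 1 := by
    rw [← LinearMap.det_comp]
    have : collLin ω ∘ₗ collLin ω = LinearMap.id := by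
      ext1 <;> ext1 <;> exact collLin_invol ω _
    rw [this, LinearMap.det_id]
  intro h
  simp [h] at this

lemma ae_coll {p : R3 × R3 → Prop} (ω : S2) (h : ∀ᵐ z ∂(volume : Measure (R3 × R3)), p z) :
    ∀ᵐ z ∂(volume : Measure (R3 × R3)), p (vPrime z.1 z.2 ω, vsPrime z.1 z.2 ω) := by
  have : (volume : Measure (R3 × R3)) (collLin ω ⁻¹' {z | ¬ p z}) = 0 := by
    have : (volume : Measure (R3 × R3)).IsAddHaarMeasure :=
      inferInstanceAs (((volume : Measure R3).prod (volume : Measure R3)).IsAddHaarMeasure)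
    rw [Measure.addHaar_preimage_linearMap _ (collLin_det ω)]
    rw [ae_iff] at h
    rw [h, mul_zero]
  rw [ae_iff]
  exact this

lemma continuous_vPrime : Continuous (fun z : R3 × R3 × S2 => vPrime z.1 z.2.1 z.2.2) := by
  unfold vPrime; fun_prop

lemma continuous_vsPrime : Continuous (fun z : R3 × R3 × S2 => vsPrime z.1 z.2.1 z.2.2) := by
  unfold vsPrime; fun_prop

lemma meas_vPrime {α : Type*} [MeasurableSpace α] {v vs : α → R3} {ω : α → S2}
    (h1 : Measurable v) (h2 : Measurable vs) (h3 : Measurable ω) :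
    Measurable (fun a => vPrime (v a) (vs a) (ω a)) :=
  continuous_vPrime.measurable.comp (h1.prodMk (h2.prodMk h3))

lemma meas_vsPrime {α : Type*} [MeasurableSpace α] {v vs : α → R3} {ω : α → S2}
    (h1 : Measurable v) (h2 : Measurable vs) (h3 : Measurable ω) :
    Measurable (fun a => vsPrime (v a) (vs a) (ω a)) :=
  continuous_vsPrime.measurable.comp (h1.prodMk (h2.prodMk h3))

/-- For a null set `N` in velocity, for a.e. `v`, all relevant velocities avoid `N`. -/
lemma ae_velocities {S : Set R3} (hS : MeasurableSet S) (h : ∀ᵐ v : R3, v ∈ S) :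
    ∀ᵐ v : R3, v ∈ S ∧ ∀ᵐ ω ∂sphMeasure, ∀ᵐ vs : R3,
      vs ∈ S ∧ vPrime v vs ω ∈ S ∧ vsPrime v vs ω ∈ S := by
  refine h.and ?_
  set P : S2 × R3 → R3 → Prop := fun z vs =>
    vs ∈ S ∧ vPrime z.2 vs z.1 ∈ S ∧ vsPrime z.2 vs z.1 ∈ S with hP
  have hm : MeasurableSet {y : (S2 × R3) × R3 | P y.1 y.2} := by
    refine (measurable_snd hS).inter (MeasurableSet.inter ?_ ?_)
    · exact (meas_vPrime (v := fun y : (S2 × R3) × R3 => y.1.2) (vs := fun y => y.2)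
        (ω := fun y => y.1.1) (by fun_prop) (by fun_prop) (by fun_prop)) hS
    · exact (meas_vsPrime (v := fun y : (S2 × R3) × R3 => y.1.2) (vs := fun y => y.2)
        (ω := fun y => y.1.1) (by fun_prop) (by fun_prop) (by fun_prop)) hS
  have hm2 : MeasurableSet {z : S2 × R3 | ∀ᵐ vs : R3, P (z.1, z.2) vs} := by
    have := measurable_measure_prodMk_left (ν := (volume : Measure R3)) hm.compl
      (measurableSet_singleton 0)
    exact this
  refine (Measure.ae_ae_comm (μ := sphMeasure) (ν := (volume : Measure R3))
    (p := fun ω v => ∀ᵐ vs : R3, P (ω, v) vs) hm2).1 ?_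
  refine Filter.Eventually.of_forall fun ω => ?_
  have h1 : ∀ᵐ z ∂(volume : Measure (R3 × R3)), z.1 ∈ S ∧ z.2 ∈ S := by
    have a1 := Measure.quasiMeasurePreserving_fst (μ := (volume : Measure R3))
      (ν := (volume : Measure R3)) |>.ae h
    have a2 := Measure.quasiMeasurePreserving_snd (μ := (volume : Measure R3))
      (ν := (volume : Measure R3)) |>.ae h
    exact a1.and a2
  have h2 := ae_coll ω h1
  have h3 := h1.and h2
  have h4 := Measure.ae_ae_of_ae_prod h3
  filter_upwards [h4] with v hv
  filter_upwards [hv] with vs hvs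
  exact ⟨hvs.1.2, hvs.2⟩

/-- The collision integrand without kernel. -/
def integrandP (f : R3 → ℝ) (v vs : R3) (ω : S2) : ℝ :=
  f (vPrime v vs ω) * f (vsPrime v vs ω) * (1 - f v) * (1 - f vs)
          - f v * f vs * (1 - f (vPrime v vs ω)) * (1 - f (vsPrime v vs ω))

lemma Qcoll_congr_ae (b : R3 × S2 → ℝ) {f g : R3 → ℝ} (hf : Measurable f) (hg : Measurable g)
    (h : ∀ᵐ v : R3, f v = g v) : ∀ᵐ v : R3, Qcoll b f v = Qcoll b g v := by
  have hS : MeasurableSet {v | f v = g v} := measurableSet_eq_fun hf hg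
  filter_upwards [ae_velocities hS h] with v hv
  obtain ⟨h1, h2⟩ := hv
  unfold Qcoll
  refine integral_congr_ae ?_
  filter_upwards [h2] with ω hω
  refine integral_congr_ae ?_
  filter_upwards [hω] with vs hvs
  obtain ⟨e1, e2, e3⟩ := hvs
  change f _ = g _ at h1 e1 e2 e3
  simp only [h1, e1, e2, e3]

lemma measurable_Qcoll {α : Type*} [MeasurableSpace α] {b : R3 × S2 → ℝ} (hb : Measurable b)
    {F : α → R3 → ℝ} (hF : Measurable (Function.uncurry F)) {v : α → R3} (hv : Measurable v) :
    Measurable (fun a => Qcoll b (F a) (v a)) := by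
  unfold Qcoll
  refine StronglyMeasurable.measurable ?_
  refine StronglyMeasurable.integral_prod_right (f := fun a ω => ∫ vs : R3,
      b (v a - vs, ω) *
        (F a (vPrime (v a) vs ω) * F a (vsPrime (v a) vs ω) * (1 - F a (v a)) * (1 - F a vs)
          - F a (v a) * F a vs * (1 - F a (vPrime (v a) vs ω)) * (1 - F a (vsPrime (v a) vs ω)))) ?_
  refine StronglyMeasurable.integral_prod_right (f := fun (z : α × S2) vs =>
      b (v z.1 - vs, z.2) *
        (F z.1 (vPrime (v z.1) vs z.2) * F z.1 (vsPrime (v z.1) vs z.2) * (1 - F z.1 (v z.1)) * (1 - F z.1 vs)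
          - F z.1 (v z.1) * F z.1 vs * (1 - F z.1 (vPrime (v z.1) vs z.2)) * (1 - F z.1 (vsPrime (v z.1) vs z.2)))) ?_
  refine Measurable.stronglyMeasurable ?_
  have m1 : Measurable (fun y : (α × S2) × R3 => F y.1.1 (vPrime (v y.1.1) y.2 y.1.2)) :=
    hF.comp (Measurable.prodMk (by fun_prop) (meas_vPrime (by fun_prop) (by fun_prop) (by fun_prop)))
  have m2 : Measurable (fun y : (α × S2) × R3 => F y.1.1 (vsPrime (v y.1.1) y.2 y.1.2)) :=
    hF.comp (Measurable.prodMk (by fun_prop) (meas_vsPrime (by fun_prop) (by fun_prop) (by fun_prop)))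
  have m3 : Measurable (fun y : (α × S2) × R3 => F y.1.1 (v y.1.1)) :=
    hF.comp (Measurable.prodMk (by fun_prop) (by fun_prop))
  have m4 : Measurable (fun y : (α × S2) × R3 => F y.1.1 y.2) :=
    hF.comp (Measurable.prodMk (by fun_prop) (by fun_prop))
  have m5 : Measurable (fun y : (α × S2) × R3 => b (v y.1.1 - y.2, y.1.2)) :=
    hb.comp (Measurable.prodMk (by fun_prop) (by fun_prop))
  exact m5.mul ((((m1.mul m2).mul (measurable_const.sub m3)).mul (measurable_const.sub m4)).sub
    (((m3.mul m4).mul (measurable_const.sub m1)).mul (measurable_const.sub m2)))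

section bounds

variable {b : R3 × S2 → ℝ}

lemma integrable_shift (hb_int : Integrable b ((volume : Measure R3).prod sphMeasure)) (v : R3) :
    Integrable (fun z : R3 × S2 => b (v - z.1, z.2)) ((volume : Measure R3).prod sphMeasure) := by
  have := (Measure.measurePreserving_sub_left (volume : Measure R3) v).prod
    (MeasurePreserving.id sphMeasure)
  exact this.integrable_comp_of_integrable hb_int

lemma integral_shift (b : R3 × S2 → ℝ) (v : R3) :
    ∫ z : R3 × S2, b (v - z.1, z.2) ∂((volume : Measure R3).prod sphMeasure) =
      ∫ z, b z ∂((volume : Measure R3).prod sphMeasure) := by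
  have := (Measure.measurePreserving_sub_left (volume : Measure R3) v).prod
    (MeasurePreserving.id sphMeasure)
  refine this.integral_comp ?_ b
  exact (MeasurableEquiv.prodCongr (MeasurableEquiv.subLeft v)
    (MeasurableEquiv.refl S2)).measurableEmbedding

lemma meas_integrandP {f : R3 → ℝ} (hf : Measurable f) (v : R3) :
    Measurable (fun z : R3 × S2 => integrandP f v z.1 z.2) := by
  have m1 : Measurable (fun y : R3 × S2 => f (vPrime v y.1 y.2)) :=
    hf.comp (meas_vPrime (by fun_prop) (by fun_prop) (by fun_prop))
  have m2 : Measurable (fun y : R3 × S2 => f (vsPrime v y.1 y.2)) :=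
    hf.comp (meas_vsPrime (by fun_prop) (by fun_prop) (by fun_prop))
  have m4 : Measurable (fun y : R3 × S2 => f y.1) := hf.comp (by fun_prop)
  unfold integrandP
  exact ((((m1.mul m2).mul measurable_const).mul (measurable_const.sub m4)).sub
    (((measurable_const.mul m4).mul (measurable_const.sub m1)).mul (measurable_const.sub m2)))

lemma abs_integrandP_le {f : R3 → ℝ} (h : ∀ v, 0 ≤ f v ∧ f v ≤ 1) (v vs : R3) (ω : S2) :
    |integrandP f v vs ω| ≤ 1 := by
  unfold integrandP
  have key : ∀ a b c d : ℝ, 0 ≤ a → a ≤ 1 → 0 ≤ b → b ≤ 1 → 0 ≤ c → c ≤ 1 → 0 ≤ d → d ≤ 1 →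
      0 ≤ a * b * c * d ∧ a * b * c * d ≤ 1 := by
    intro a b c d ha ha' hb hb' hc hc' hd hd'
    refine ⟨by positivity, ?_⟩
    exact mul_le_one₀ (mul_le_one₀ (mul_le_one₀ ha' hb hb') hc hc') hd hd'
  have sub1 : ∀ v, 0 ≤ 1 - f v ∧ 1 - f v ≤ 1 := fun v => ⟨by linarith [h v], by linarith [h v]⟩
  have k1 := key _ _ _ _ (h (vPrime v vs ω)).1 (h (vPrime v vs ω)).2 (h (vsPrime v vs ω)).1
    (h (vsPrime v vs ω)).2 (sub1 v).1 (sub1 v).2 (sub1 vs).1 (sub1 vs).2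
  have k2 := key _ _ _ _ (h v).1 (h v).2 (h vs).1 (h vs).2 (sub1 (vPrime v vs ω)).1
    (sub1 (vPrime v vs ω)).2 (sub1 (vsPrime v vs ω)).1 (sub1 (vsPrime v vs ω)).2
  rw [abs_le]
  constructor <;> linarith

lemma prod4_lip {a b c d a' b' c' d' D : ℝ} (_ : |a| ≤ 1) (hb : |b| ≤ 1)
    (hc : |c| ≤ 1) (hd : |d| ≤ 1) (ha' : |a'| ≤ 1) (hb' : |b'| ≤ 1)
    (hc' : |c'| ≤ 1) (_ : |d'| ≤ 1) (h1 : |a - a'| ≤ D) (h2 : |b - b'| ≤ D)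
    (h3 : |c - c'| ≤ D) (h4 : |d - d'| ≤ D) : |a * b * c * d - a' * b' * c' * d'| ≤ 4 * D := by
  have step : ∀ {x y x' y' E : ℝ}, |x'| ≤ 1 → |y| ≤ 1 → |x - x'| ≤ E → |y - y'| ≤ D →
      |x * y - x' * y'| ≤ E + D := by
    intro x y x' y' E hx' hy hx hy'
    have : x * y - x' * y' = (x - x') * y + x' * (y - y') := by ring
    rw [this]
    refine (abs_add_le _ _).trans ?_
    rw [abs_mul, abs_mul]
    have e1 := mul_le_mul_of_nonneg_left hy (abs_nonneg (x - x'))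
    have e2 := mul_le_mul_of_nonneg_right hx' (abs_nonneg (y - y'))
    linarith
  have m2 : |a' * b'| ≤ 1 := by rw [abs_mul]; exact mul_le_one₀ ha' (abs_nonneg _) hb'
  have m3 : |a' * b' * c'| ≤ 1 := by rw [abs_mul]; exact mul_le_one₀ m2 (abs_nonneg _) hc'
  have := step m3 hd (step m2 hc (step ha' hb h1 h2) h3) h4
  linarith

lemma integrandP_lip {f g : R3 → ℝ} (hf : ∀ v, 0 ≤ f v ∧ f v ≤ 1) (hg : ∀ v, 0 ≤ g v ∧ g v ≤ 1)
    {D : ℝ} (hD : ∀ v, |f v - g v| ≤ D) (v vs : R3) (ω : S2) :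
    |integrandP f v vs ω - integrandP g v vs ω| ≤ 8 * D := by
  have af : ∀ v, |f v| ≤ 1 := fun v => abs_le.2 ⟨by linarith [hf v], (hf v).2⟩
  have ag : ∀ v, |g v| ≤ 1 := fun v => abs_le.2 ⟨by linarith [hg v], (hg v).2⟩
  have sf : ∀ v, |1 - f v| ≤ 1 := fun v => abs_le.2 ⟨by linarith [hf v], by linarith [hf v]⟩
  have sg : ∀ v, |1 - g v| ≤ 1 := fun v => abs_le.2 ⟨by linarith [hg v], by linarith [hg v]⟩
  have sD : ∀ v, |(1 - f v) - (1 - g v)| ≤ D := fun v => by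
    rw [show (1 - f v) - (1 - g v) = -(f v - g v) by ring, abs_neg]; exact hD v
  unfold integrandP
  have k1 := prod4_lip (af (vPrime v vs ω)) (af (vsPrime v vs ω)) (sf v) (sf vs)
    (ag (vPrime v vs ω)) (ag (vsPrime v vs ω)) (sg v) (sg vs) (hD _) (hD _) (sD _) (sD _)
  have k2 := prod4_lip (af v) (af vs) (sf (vPrime v vs ω)) (sf (vsPrime v vs ω))
    (ag v) (ag vs) (sg (vPrime v vs ω)) (sg (vsPrime v vs ω)) (hD _) (hD _) (sD _) (sD _)
  rw [abs_le] at *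
  constructor <;> linarith

lemma integrable_Q (hb_int : Integrable b ((volume : Measure R3).prod sphMeasure))
    {f : R3 → ℝ} (hf : Measurable f) (h : ∀ v, 0 ≤ f v ∧ f v ≤ 1) (v : R3) :
    Integrable (fun z : R3 × S2 => b (v - z.1, z.2) * integrandP f v z.1 z.2)
      ((volume : Measure R3).prod sphMeasure) := by
  refine (integrable_shift hb_int v).mul_bdd (c := 1) (meas_integrandP hf v).aestronglyMeasurable ?_
  exact Filter.Eventually.of_forall fun z => abs_integrandP_le h _ _ _

lemma Qcoll_eq (hb_int : Integrable b ((volume : Measure R3).prod sphMeasure))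
    {f : R3 → ℝ} (hf : Measurable f) (h : ∀ v, 0 ≤ f v ∧ f v ≤ 1) (v : R3) :
    Qcoll b f v = ∫ z : R3 × S2, b (v - z.1, z.2) * integrandP f v z.1 z.2
      ∂((volume : Measure R3).prod sphMeasure) := by
  rw [integral_prod_symm _ (integrable_Q hb_int hf h v)]
  rfl

lemma abs_Qcoll_le (hb_nonneg : ∀ p, 0 ≤ b p)
    (hb_int : Integrable b ((volume : Measure R3).prod sphMeasure))
    {f : R3 → ℝ} (hf : Measurable f) (h : ∀ v, 0 ≤ f v ∧ f v ≤ 1) (v : R3) :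
    |Qcoll b f v| ≤ ∫ z, b z ∂((volume : Measure R3).prod sphMeasure) := by
  rw [Qcoll_eq hb_int hf h, ← integral_shift b v, ← Real.norm_eq_abs]
  refine norm_integral_le_of_norm_le (integrable_shift hb_int v) (Filter.Eventually.of_forall ?_)
  intro z
  rw [norm_mul, Real.norm_of_nonneg (hb_nonneg _)]
  exact mul_le_of_le_one_right (hb_nonneg _) (abs_integrandP_le h _ _ _)

lemma Qcoll_lip (hb_nonneg : ∀ p, 0 ≤ b p)
    (hb_int : Integrable b ((volume : Measure R3).prod sphMeasure))
    {f g : R3 → ℝ} (hf : Measurable f) (h : ∀ v, 0 ≤ f v ∧ f v ≤ 1)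
    (hg : Measurable g) (h' : ∀ v, 0 ≤ g v ∧ g v ≤ 1)
    {D : ℝ} (hD : ∀ v, |f v - g v| ≤ D) (v : R3) :
    |Qcoll b f v - Qcoll b g v| ≤
      (∫ z, b z ∂((volume : Measure R3).prod sphMeasure)) * (8 * D) := by
  rw [Qcoll_eq hb_int hf h, Qcoll_eq hb_int hg h',
    ← integral_sub (integrable_Q hb_int hf h v) (integrable_Q hb_int hg h' v),
    ← integral_shift b v, ← integral_mul_const, ← Real.norm_eq_abs]
  refine norm_integral_le_of_norm_le ((integrable_shift hb_int v).mul_const _)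
    (Filter.Eventually.of_forall ?_)
  intro z
  rw [← mul_sub, norm_mul, Real.norm_of_nonneg (hb_nonneg _)]
  exact mul_le_mul_of_nonneg_left (integrandP_lip h h' hD _ _ _) (hb_nonneg _)

lemma Qcoll_nonneg (hb_nonneg : ∀ p, 0 ≤ b p) {f : R3 → ℝ}
    (h : ∀ v, 0 ≤ f v ∧ f v ≤ 1) {v : R3} (hv : f v = 0) : 0 ≤ Qcoll b f v := by
  unfold Qcoll
  refine integral_nonneg fun ω => integral_nonneg fun vs => ?_
  refine mul_nonneg (hb_nonneg _) ?_
  rw [hv]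
  have h1 := (h (vPrime v vs ω)).1
  have h2 := (h (vsPrime v vs ω)).1
  have h3 : 0 ≤ 1 - f vs := by linarith [h vs]
  have := mul_nonneg (mul_nonneg h1 h2) h3
  simp; linarith

lemma Qcoll_nonpos (hb_nonneg : ∀ p, 0 ≤ b p) {f : R3 → ℝ}
    (h : ∀ v, 0 ≤ f v ∧ f v ≤ 1) {v : R3} (hv : f v = 1) : Qcoll b f v ≤ 0 := by
  unfold Qcoll
  refine integral_nonpos fun ω => integral_nonpos fun vs => ?_
  refine mul_nonpos_of_nonneg_of_nonpos (hb_nonneg _) ?_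
  rw [hv]
  have h1 : 0 ≤ 1 - f (vPrime v vs ω) := by linarith [h (vPrime v vs ω)]
  have h2 : 0 ≤ 1 - f (vsPrime v vs ω) := by linarith [h (vsPrime v vs ω)]
  have h3 := (h vs).1
  have := mul_nonneg (mul_nonneg h3 h1) h2
  simp; linarith

lemma Qcoll_tendsto (hb_nonneg : ∀ p, 0 ≤ b p)
    (hb_int : Integrable b ((volume : Measure R3).prod sphMeasure))
    {F : ℕ → R3 → ℝ} {f : R3 → ℝ} (hF : ∀ n, Measurable (F n)) (h : ∀ n v, 0 ≤ F n v ∧ F n v ≤ 1)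
    (hf : Measurable f) (h' : ∀ v, 0 ≤ f v ∧ f v ≤ 1)
    (hlim : ∀ v, Filter.Tendsto (fun n => F n v) Filter.atTop (nhds (f v))) (v : R3) :
    Filter.Tendsto (fun n => Qcoll b (F n) v) Filter.atTop (nhds (Qcoll b f v)) := by
  rw [Qcoll_eq hb_int hf h']
  simp_rw [fun n => Qcoll_eq hb_int (hF n) (h n) v]
  refine tendsto_integral_of_dominated_convergence _
    (fun n => (integrable_Q hb_int (hF n) (h n) v).aestronglyMeasurable)
    (integrable_shift hb_int v) (fun n => Filter.Eventually.of_forall fun z => ?_)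
    (Filter.Eventually.of_forall fun z => ?_)
  · rw [norm_mul, Real.norm_of_nonneg (hb_nonneg _)]
    exact mul_le_of_le_one_right (hb_nonneg _) (abs_integrandP_le (h n) _ _ _)
  · refine Filter.Tendsto.const_mul _ ?_
    unfold integrandP
    exact ((((hlim _).mul (hlim _)).mul ((hlim _).const_sub 1)).mul ((hlim _).const_sub 1)).sub
      ((((hlim _).mul (hlim _)).mul ((hlim _).const_sub 1)).mul ((hlim _).const_sub 1))

end bounds

lemma shear_mp (t : ℝ) : MeasurePreserving (fun q : R3 × R3 => (q.1 + t • q.2, q.2))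
    (volume : Measure (R3 × R3)) volume := by
  have h1 : MeasurePreserving (fun p : R3 × R3 => (id p.1, p.2 + t • p.1))
      ((volume : Measure R3).prod (volume : Measure R3)) (volume.prod volume) := by
    refine MeasurePreserving.skew_product (g := fun v x => x + t • v)
      (MeasurePreserving.id (volume : Measure R3)) ?_ (Filter.Eventually.of_forall fun v => ?_)
    · exact (by fun_prop : Measurable fun p : R3 × R3 => p.2 + t • p.1)
    · exact (measurePreserving_add_right (volume : Measure R3) (t • v)).map_eq
  have h2 := (Measure.measurePreserving_swap (μ := (volume : Measure R3))
    (ν := (volume : Measure R3))).comp (h1.comp (Measure.measurePreserving_swap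
      (μ := (volume : Measure R3)) (ν := (volume : Measure R3))))
  exact h2

lemma ae_char {S : Set (ℝ × R3 × R3)} (hS : MeasurableSet S) :
    (∀ᵐ p : ℝ × R3 × R3, p ∈ S) ↔
      ∀ᵐ q : R3 × R3, ∀ᵐ t : ℝ, (t, q.1 + t • q.2, q.2) ∈ S := by
  have hS' : MeasurableSet {z : ℝ × R3 × R3 | (z.1, z.2.1 + z.1 • z.2.2, z.2.2) ∈ S} :=
    (by fun_prop : Measurable fun z : ℝ × R3 × R3 => (z.1, z.2.1 + z.1 • z.2.2, z.2.2)) hS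
  have h1 := Measure.ae_prod_iff_ae_ae (μ := (volume : Measure ℝ))
    (ν := (volume : Measure (R3 × R3))) (p := fun p => p ∈ S) hS
  have h2 := Measure.ae_ae_comm (μ := (volume : Measure ℝ))
    (ν := (volume : Measure (R3 × R3)))
    (p := fun t q => (t, q.1 + t • q.2, q.2) ∈ S) hS'
  refine h1.trans (Iff.trans ?_ h2)
  refine Filter.eventually_congr (Filter.Eventually.of_forall fun t => ?_)
  have hSt : MeasurableSet {q : R3 × R3 | (t, q) ∈ S} := measurable_prodMk_left hS
  have := ae_map_iff (μ := (volume : Measure (R3 × R3))) (shear_mp t).measurable.aemeasurable hSt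
  rw [(shear_mp t).map_eq] at this
  exact this

/-- the collision operator on functions on phase space-time -/
def QF (b : R3 × S2 → ℝ) (g : ℝ × R3 × R3 → ℝ) (p : ℝ × R3 × R3) : ℝ :=
  Qcoll b (fun w => g (p.1, p.2.1, w)) p.2.2

lemma measurable_QF {b : R3 × S2 → ℝ} (hb : Measurable b) {g : ℝ × R3 × R3 → ℝ}
    (hg : Measurable g) : Measurable (QF b g) := by
  refine measurable_Qcoll hb (F := fun (p : ℝ × R3 × R3) w => g (p.1, p.2.1, w)) ?_ (by fun_prop)
  exact hg.comp (by fun_prop : Measurable fun z : (ℝ × R3 × R3) × R3 => (z.1.1, z.1.2.1, z.2))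

lemma QF_congr_ae {b : R3 × S2 → ℝ} (hb : Measurable b) {g g' : ℝ × R3 × R3 → ℝ}
    (hg : Measurable g) (hg' : Measurable g') (h : ∀ᵐ p : ℝ × R3 × R3, 0 ≤ p.1 → g p = g' p) :
    ∀ᵐ q : R3 × R3, ∀ᵐ s : ℝ, 0 ≤ s →
      QF b g (s, q.1 + s • q.2, q.2) = QF b g' (s, q.1 + s • q.2, q.2) := by
  have hS : MeasurableSet {p : ℝ × R3 × R3 | 0 ≤ p.1 → QF b g p = QF b g' p} := by
    have e : {p : ℝ × R3 × R3 | 0 ≤ p.1 → QF b g p = QF b g' p} =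
        {p | 0 ≤ p.1}ᶜ ∪ {p | QF b g p = QF b g' p} := by
      ext p; exact imp_iff_not_or
    rw [e]
    exact (measurableSet_le measurable_const measurable_fst).compl.union
      (measurableSet_eq_fun (measurable_QF hb hg) (measurable_QF hb hg'))
  refine (ae_char hS).1 ?_
  refine (Measure.ae_prod_iff_ae_ae (μ := (volume : Measure ℝ))
    (ν := (volume : Measure (R3 × R3))) hS).2 ?_
  filter_upwards [Measure.ae_ae_of_ae_prod h] with s hs
  have hSs : MeasurableSet {q : R3 × R3 | 0 ≤ s → QF b g (s, q) = QF b g' (s, q)} :=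
    measurable_prodMk_left (x := s) hS
  refine (Measure.ae_prod_iff_ae_ae (μ := (volume : Measure R3))
    (ν := (volume : Measure R3)) hSs).2 ?_
  filter_upwards [Measure.ae_ae_of_ae_prod hs] with y hy
  by_cases h0 : 0 ≤ s
  · have := Qcoll_congr_ae b (f := fun w => g (s, y, w)) (g := fun w => g' (s, y, w))
      (hg.comp (by fun_prop)) (hg'.comp (by fun_prop)) (hy.mono fun v hv => hv h0)
    filter_upwards [this] with v hv _
    exact hv
  · exact Filter.Eventually.of_forall fun v h => absurd h h0

/-- measurable, with values in `[0,1]` for nonnegative times -/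
def Good (f : ℝ × R3 × R3 → ℝ) : Prop :=
  Measurable f ∧ ∀ p : ℝ × R3 × R3, 0 ≤ p.1 → 0 ≤ f p ∧ f p ≤ 1

section est

variable {b : R3 × S2 → ℝ}

/-- the mass of the kernel -/
def mass (b : R3 × S2 → ℝ) : ℝ := ∫ z, b z ∂((volume : Measure R3).prod sphMeasure)

lemma Good.slice {f : ℝ × R3 × R3 → ℝ} (hf : Good f) (s : ℝ) (y : R3) :
    Measurable (fun w => f (s, y, w)) := hf.1.comp (by fun_prop)

lemma abs_QF_le (hb_nonneg : ∀ p, 0 ≤ b p)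
    (hb_int : Integrable b ((volume : Measure R3).prod sphMeasure))
    {f : ℝ × R3 × R3 → ℝ} (hf : Good f) (p : ℝ × R3 × R3) (hp : 0 ≤ p.1) :
    |QF b f p| ≤ mass b :=
  abs_Qcoll_le hb_nonneg hb_int (hf.slice _ _) (fun w => hf.2 (_, _, w) hp) _

lemma meas_char {b : R3 × S2 → ℝ} (hb : Measurable b) {f : ℝ × R3 × R3 → ℝ}
    (hf : Measurable f) (x v : R3) :
    Measurable (fun s : ℝ => QF b f (s, x + s • v, v)) :=
  (measurable_QF hb hf).comp (by fun_prop)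

lemma intble_char (hb_meas : Measurable b) (hb_nonneg : ∀ p, 0 ≤ b p)
    (hb_int : Integrable b ((volume : Measure R3).prod sphMeasure))
    {f : ℝ × R3 × R3 → ℝ} (hf : Good f) (x v : R3) {s t : ℝ} (hs : 0 ≤ s) (ht : 0 ≤ t) :
    IntervalIntegrable (fun s : ℝ => QF b f (s, x + s • v, v)) volume s t := by
  refine (intervalIntegrable_const (c := mass b)).mono_fun
    (meas_char hb_meas hf.1 x v).aestronglyMeasurable ?_
  refine (ae_restrict_iff' measurableSet_uIoc).2 (Filter.Eventually.of_forall fun r hr => ?_)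
  have hr0 : 0 ≤ r := (le_min hs ht).trans hr.1.le
  exact (abs_QF_le hb_nonneg hb_int hf (r, _, _) hr0).trans (le_abs_self _)

lemma mass_nonneg (hb_nonneg : ∀ p, 0 ≤ b p) : 0 ≤ mass b := integral_nonneg hb_nonneg

/-- the exponential rate -/
def lam (b : R3 × S2 → ℝ) : ℝ := 16 * mass b + 1

lemma est (hb_meas : Measurable b) (hb_nonneg : ∀ p, 0 ≤ b p)
    (hb_int : Integrable b ((volume : Measure R3).prod sphMeasure))
    {f g : ℝ × R3 × R3 → ℝ} (hf : Good f) (hg : Good g) {C : ℝ} (hC : 0 ≤ C)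
    (h : ∀ p : ℝ × R3 × R3, 0 ≤ p.1 → |g p - f p| ≤ C * Real.exp (lam b * p.1))
    (x v : R3) {t : ℝ} (ht : 0 ≤ t) :
    |(∫ s in (0 : ℝ)..t, QF b g (s, x + s • v, v)) - ∫ s in (0 : ℝ)..t, QF b f (s, x + s • v, v)|
      ≤ C / 2 * Real.exp (lam b * t) := by
  have hB := mass_nonneg hb_nonneg
  have hl : 0 < lam b := by unfold lam; linarith
  rw [← intervalIntegral.integral_sub (intble_char hb_meas hb_nonneg hb_int hg x v le_rfl ht)
    (intble_char hb_meas hb_nonneg hb_int hf x v le_rfl ht), ← Real.norm_eq_abs]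
  have hI : IntervalIntegrable (fun s => (mass b * 8 * C) * Real.exp (lam b * s)) volume 0 t :=
    Continuous.intervalIntegrable (by fun_prop) _ _
  refine (intervalIntegral.norm_integral_le_of_norm_le ht
    (g := fun s => (mass b * 8 * C) * Real.exp (lam b * s)) ?_ hI).trans ?_
  · refine Filter.Eventually.of_forall fun s hs => ?_
    have := Qcoll_lip hb_nonneg hb_int (hg.slice s (x + s • v)) (fun w => hg.2 (_, _, w) hs.1.le)
      (hf.slice s (x + s • v)) (fun w => hf.2 (_, _, w) hs.1.le)
      (D := C * Real.exp (lam b * s)) (fun w => h (s, _, w) hs.1.le) v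
    refine this.trans (le_of_eq ?_)
    change mass b * _ = _
    ring
  · rw [intervalIntegral.integral_const_mul,
      intervalIntegral.integral_comp_mul_left (fun x => Real.exp x) hl.ne', integral_exp]
    rw [mul_zero, Real.exp_zero, smul_eq_mul]
    have he := Real.exp_pos (lam b * t)
    have h8 : mass b * 8 * (lam b)⁻¹ ≤ 1 / 2 := by
      rw [mul_inv_le_iff₀ hl]; unfold lam; linarith
    have h0 : 0 ≤ mass b * 8 * (lam b)⁻¹ := by positivity
    calc mass b * 8 * C * ((lam b)⁻¹ * (Real.exp (lam b * t) - 1))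
        = (mass b * 8 * (lam b)⁻¹) * (C * (Real.exp (lam b * t) - 1)) := by ring
      _ ≤ (mass b * 8 * (lam b)⁻¹) * (C * Real.exp (lam b * t)) := by
          gcongr; linarith
      _ ≤ 1 / 2 * (C * Real.exp (lam b * t)) := by gcongr
      _ = _ := by ring

lemma lip_char (hb_nonneg : ∀ p, 0 ≤ b p)
    (hb_int : Integrable b ((volume : Measure R3).prod sphMeasure))
    {f : ℝ × R3 × R3 → ℝ} (hf : Good f) (x v : R3) {s t : ℝ} (hs : 0 ≤ s) (hst : s ≤ t) :
    |∫ r in s..t, QF b f (r, x + r • v, v)| ≤ mass b * (t - s) := by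
  have := intervalIntegral.norm_integral_le_of_norm_le_const (a := s) (b := t) (C := mass b)
    (f := fun r => QF b f (r, x + r • v, v)) (fun r hr => by
      rw [Set.uIoc_of_le hst] at hr
      exact abs_QF_le hb_nonneg hb_int hf (r, _, _) (hs.trans hr.1.le))
  rwa [abs_of_nonneg (sub_nonneg.2 hst)] at this

end est

/-- A scalar comparison principle. -/
lemma stay_nonneg {a : ℝ} (ha : 0 ≤ a) {q : ℝ → ℝ}
    (hq : ∀ s t, 0 ≤ s → 0 ≤ t → IntervalIntegrable q volume s t)
    (hc : ContinuousOn (fun t => a + ∫ s in (0 : ℝ)..t, q s) (Set.Ici 0))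
    (h : ∀ s, 0 ≤ s → a + (∫ r in (0 : ℝ)..s, q r) ≤ 0 → 0 ≤ q s) {t : ℝ} (ht : 0 ≤ t) :
    0 ≤ a + ∫ s in (0 : ℝ)..t, q s := by
  by_contra! hneg
  set F : ℝ → ℝ := fun t => a + ∫ s in (0 : ℝ)..t, q s with hF
  set K : Set ℝ := Set.Icc 0 t ∩ F ⁻¹' Set.Ici 0 with hK
  have hKc : IsCompact K :=
    isCompact_Icc.of_isClosed_subset
      ((hc.mono Set.Icc_subset_Ici_self).preimage_isClosed_of_isClosed isClosed_Icc isClosed_Ici)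
      Set.inter_subset_left
  have hKn : K.Nonempty := ⟨0, ⟨le_rfl, ht⟩, by simp [hF, ha]⟩
  obtain ⟨τ, hτ⟩ := hKc.exists_isGreatest hKn
  have hτ0 : 0 ≤ τ := hτ.1.1.1
  have hτt : τ ≤ t := hτ.1.1.2
  have hFτ : 0 ≤ F τ := hτ.1.2
  have e : F t = F τ + ∫ s in τ..t, q s := by
    simp only [hF]
    rw [add_assoc, intervalIntegral.integral_add_adjacent_intervals (hq _ _ le_rfl hτ0)
      (hq _ _ hτ0 ht)]
  have hpos : 0 ≤ ∫ s in τ..t, q s := by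
    rw [intervalIntegral.integral_of_le hτt]
    refine setIntegral_nonneg measurableSet_Ioc fun s hs => ?_
    refine h s (hτ0.trans hs.1.le) ?_
    by_contra! hcon
    exact absurd (hτ.2 ⟨⟨hτ0.trans hs.1.le, hs.2⟩, hcon.le⟩) (not_le.2 hs.1)
  have : F t < 0 := hneg
  linarith

/-- clip to `[0,1]` -/
def clip (x : ℝ) : ℝ := max 0 (min x 1)

lemma clip_mem (x : ℝ) : 0 ≤ clip x ∧ clip x ≤ 1 :=
  ⟨le_max_left _ _, max_le zero_le_one (min_le_right _ _)⟩

lemma clip_cont : Continuous clip := by unfold clip; fun_prop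

lemma clip_of_mem {x : ℝ} (h0 : 0 ≤ x) (h1 : x ≤ 1) : clip x = x := by
  simp [clip, h0, h1]

lemma clip_of_nonpos {x : ℝ} (h0 : x ≤ 0) : clip x = 0 := by
  rw [clip, max_eq_left]; exact (min_le_left _ _).trans h0

lemma clip_of_one_le {x : ℝ} (h0 : 1 ≤ x) : clip x = 1 := by
  simp [clip, h0]

lemma clip_lip (x y : ℝ) : |clip x - clip y| ≤ |x - y| := by
  unfold clip
  refine (abs_max_sub_max_le_max _ _ _ _).trans (max_le (by simp) ?_)
  exact (abs_min_sub_min_le_max _ _ _ _).trans (max_le le_rfl (by simp))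

/-- the Picard map -/
def picard (b : R3 × S2 → ℝ) (f₀ : R3 × R3 → ℝ) (h : ℝ × R3 × R3 → ℝ) (p : ℝ × R3 × R3) : ℝ :=
  clip (clip (f₀ (p.2.1 - p.1 • p.2.2, p.2.2)) +
    ∫ s in (0 : ℝ)..(max p.1 0), QF b h (s, p.2.1 - p.1 • p.2.2 + s • p.2.2, p.2.2))

lemma picard_meas {b : R3 × S2 → ℝ} (hb : Measurable b) {f₀ : R3 × R3 → ℝ} (hf₀ : Measurable f₀)
    {h : ℝ × R3 × R3 → ℝ} (hh : Measurable h) : Measurable (picard b f₀ h) := by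
  unfold picard
  refine clip_cont.measurable.comp (Measurable.add ?_ ?_)
  · exact clip_cont.measurable.comp (hf₀.comp (by fun_prop))
  · have e : ∀ p : ℝ × R3 × R3,
      (∫ s in (0 : ℝ)..(max p.1 0), QF b h (s, p.2.1 - p.1 • p.2.2 + s • p.2.2, p.2.2)) =
      ∫ s : ℝ, (Set.indicator {z : (ℝ × R3 × R3) × ℝ | 0 < z.2 ∧ z.2 ≤ max z.1.1 0}
        (fun z => QF b h (z.2, z.1.2.1 - z.1.1 • z.1.2.2 + z.2 • z.1.2.2, z.1.2.2))) (p, s) := by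
      intro p
      rw [intervalIntegral.integral_of_le (le_max_right _ _), ← integral_indicator measurableSet_Ioc]
      rfl
    simp_rw [e]
    refine (StronglyMeasurable.integral_prod_right' (Measurable.stronglyMeasurable ?_)).measurable
    refine Measurable.indicator ((measurable_QF hb hh).comp (by fun_prop)) ?_
    exact (measurableSet_lt measurable_const measurable_snd).inter
      (measurableSet_le measurable_snd (by fun_prop))

lemma ae_restrict_time {P : ℝ × R3 × R3 → Prop} :
    (∀ᵐ p ∂(volume : Measure (ℝ × R3 × R3)).restrict
      (Set.Ici (0 : ℝ) ×ˢ (Set.univ : Set (R3 × R3))), P p) ↔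
    ∀ᵐ p : ℝ × R3 × R3, 0 ≤ p.1 → P p := by
  rw [ae_restrict_iff' (measurableSet_Ici.prod MeasurableSet.univ)]
  simp

/-- Existence of a fixed point of the Picard map. -/
lemma exists_fixed {b : R3 × S2 → ℝ} (hb_meas : Measurable b) (hb_nonneg : ∀ p, 0 ≤ b p)
    (hb_int : Integrable b ((volume : Measure R3).prod sphMeasure))
    {f₀ : R3 × R3 → ℝ} (hf₀_meas : Measurable f₀) :
    ∃ h : ℝ × R3 × R3 → ℝ, Good h ∧ ∀ p, h p = picard b f₀ h p := by
  set H : ℕ → ℝ × R3 × R3 → ℝ := fun n => (picard b f₀)^[n] (fun _ => 0) with hH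
  have hsucc : ∀ n, H (n + 1) = picard b f₀ (H n) := fun n => Function.iterate_succ_apply' _ _ _
  have hbd : ∀ n p, 0 ≤ H n p ∧ H n p ≤ 1 := by
    intro n p
    cases n with
    | zero => simp [hH]
    | succ n => rw [hsucc]; exact clip_mem _
  have hme : ∀ n, Measurable (H n) := by
    intro n
    induction n with
    | zero => exact measurable_const
    | succ n ih => rw [hsucc]; exact picard_meas hb_meas hf₀_meas ih
  have hgood : ∀ n, Good (H n) := fun n => ⟨hme n, fun p _ => hbd n p⟩
  have hl : 0 < lam b := by have := mass_nonneg hb_nonneg; unfold lam; linarith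
  have hdiff : ∀ n p, |H (n + 1) p - H n p| ≤ (1 / 2) ^ n * Real.exp (lam b * max p.1 0) := by
    intro n
    induction n with
    | zero =>
      intro p
      have h1 := hbd 1 p
      have h2 := hbd 0 p
      have h3 : 1 ≤ Real.exp (lam b * max p.1 0) := Real.one_le_exp (by positivity)
      rw [pow_zero, one_mul, abs_le]
      constructor <;> simp only [zero_add] <;> linarith
    | succ n ih =>
      intro p
      rw [hsucc (n + 1), hsucc n]
      refine (clip_lip _ _).trans ?_
      rw [add_sub_add_left_eq_sub]
      have ih' : ∀ p : ℝ × R3 × R3, 0 ≤ p.1 →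
          |picard b f₀ (H n) p - H n p| ≤ (1 / 2) ^ n * Real.exp (lam b * p.1) := by
        intro p hp
        have := ih p
        rwa [max_eq_left hp, hsucc n] at this
      have hg1 := hgood (n + 1)
      rw [hsucc n] at hg1
      have := est hb_meas hb_nonneg hb_int (hgood n) hg1 (by positivity) ih'
        (p.2.1 - p.1 • p.2.2) p.2.2 (le_max_right p.1 0)
      refine this.trans (le_of_eq ?_)
      rw [pow_succ]; ring
  have hconv : ∀ p, ∃ l, Filter.Tendsto (fun n => H n p) Filter.atTop (nhds l) := by
    intro p
    refine cauchySeq_tendsto_of_complete (cauchySeq_of_le_geometric (1 / 2)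
      (Real.exp (lam b * max p.1 0)) (by norm_num) fun n => ?_)
    rw [dist_comm, Real.dist_eq, mul_comm]
    exact hdiff n p
  choose h hh using hconv
  have hhm : Measurable h := measurable_of_tendsto_metrizable hme (tendsto_pi_nhds.2 hh)
  have hhb : ∀ p, 0 ≤ h p ∧ h p ≤ 1 := fun p =>
    ⟨ge_of_tendsto' (hh p) fun n => (hbd n p).1, le_of_tendsto' (hh p) fun n => (hbd n p).2⟩
  refine ⟨h, ⟨hhm, fun p _ => hhb p⟩, fun p => ?_⟩
  have hQ : ∀ p, Filter.Tendsto (fun n => QF b (H n) p) Filter.atTop (nhds (QF b h p)) := fun p =>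
    Qcoll_tendsto hb_nonneg hb_int (fun n => (hgood n).slice _ _) (fun n v => hbd n _)
      (hhm.comp (by fun_prop)) (fun v => hhb _) (fun v => hh _) _
  have h1 : Filter.Tendsto (fun n => H (n + 1) p) Filter.atTop (nhds (h p)) :=
    (hh p).comp (Filter.tendsto_add_atTop_nat 1)
  refine tendsto_nhds_unique h1 ?_
  simp_rw [hsucc]
  refine (clip_cont.tendsto _).comp (Filter.Tendsto.const_add _ ?_)
  refine intervalIntegral.tendsto_integral_filter_of_dominated_convergence (fun _ => mass b)
    (Filter.Eventually.of_forall fun n =>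
      (meas_char hb_meas (hme n) (p.2.1 - p.1 • p.2.2) p.2.2).aestronglyMeasurable)
    (Filter.Eventually.of_forall fun n => Filter.Eventually.of_forall fun s hs => ?_)
    intervalIntegrable_const (Filter.Eventually.of_forall fun s _ => hQ _)
  rw [Set.uIoc_of_le (le_max_right _ _)] at hs
  exact abs_QF_le hb_nonneg hb_int (hgood n) (s, _, _) hs.1.le

/-- The fixed point solves the equation along every characteristic. -/
lemma fixed_solves {b : R3 × S2 → ℝ} (hb_meas : Measurable b) (hb_nonneg : ∀ p, 0 ≤ b p)
    (hb_int : Integrable b ((volume : Measure R3).prod sphMeasure))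
    {f₀ : R3 × R3 → ℝ} {h : ℝ × R3 × R3 → ℝ} (hg : Good h) (hfix : ∀ p, h p = picard b f₀ h p)
    (x v : R3) {t : ℝ} (ht : 0 ≤ t) :
    h (t, x + t • v, v) = clip (f₀ (x, v)) + ∫ s in (0 : ℝ)..t, QF b h (s, x + s • v, v) := by
  have hc : ∀ t, 0 ≤ t → h (t, x + t • v, v) =
      clip (clip (f₀ (x, v)) + ∫ s in (0 : ℝ)..t, QF b h (s, x + s • v, v)) := by
    intro t ht
    rw [hfix, picard]
    simp only [add_sub_cancel_right, max_eq_left ht]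
  have hint := fun s t (hs : 0 ≤ s) (ht : 0 ≤ t) =>
    intble_char hb_meas hb_nonneg hb_int hg x v hs ht
  have hcont : ContinuousOn (fun t => ∫ s in (0 : ℝ)..t, QF b h (s, x + s • v, v))
      (Set.Ici 0) := by
    have hL : LipschitzOnWith (Real.toNNReal (mass b))
        (fun t => ∫ s in (0 : ℝ)..t, QF b h (s, x + s • v, v)) (Set.Ici 0) := by
      refine LipschitzOnWith.of_dist_le_mul fun s hs t ht => ?_
      rw [Real.coe_toNNReal _ (mass_nonneg hb_nonneg)]
      rcases le_total s t with hst | hst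
      · rw [dist_comm, dist_comm s, Real.dist_eq, Real.dist_eq,
          intervalIntegral.integral_interval_sub_left (hint _ _ le_rfl ht) (hint _ _ le_rfl hs),
          abs_of_nonneg (sub_nonneg.2 hst)]
        exact lip_char hb_nonneg hb_int hg x v hs hst
      · rw [Real.dist_eq, Real.dist_eq,
          intervalIntegral.integral_interval_sub_left (hint _ _ le_rfl hs) (hint _ _ le_rfl ht),
          abs_of_nonneg (sub_nonneg.2 hst)]
        exact lip_char hb_nonneg hb_int hg x v ht hst
    exact hL.continuousOn
  have hcl := clip_mem (f₀ (x, v))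
  have low := stay_nonneg hcl.1 hint (continuousOn_const.add hcont) (fun s hs hle => by
    refine Qcoll_nonneg hb_nonneg (fun w => hg.2 (_, _, w) hs) ?_
    change h (s, x + s • v, v) = 0
    rw [hc s hs, clip_of_nonpos hle]) ht
  have up := stay_nonneg (a := 1 - clip (f₀ (x, v))) (q := fun s => - QF b h (s, x + s • v, v))
    (by linarith) (fun s t hs ht => (hint s t hs ht).neg)
    (by
      simp_rw [intervalIntegral.integral_neg]
      exact continuousOn_const.add hcont.neg)
    (fun s hs hle => by
      rw [intervalIntegral.integral_neg] at hle
      have : QF b h (s, x + s • v, v) ≤ 0 := by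
        refine Qcoll_nonpos hb_nonneg (fun w => hg.2 (_, _, w) hs) ?_
        change h (s, x + s • v, v) = 1
        rw [hc s hs, clip_of_one_le (by linarith)]
      linarith) ht
  rw [intervalIntegral.integral_neg] at up
  rw [hc t ht, clip_of_mem low (by linarith)]

/-- Uniqueness among bounded mild solutions. -/
lemma unique_aux {b : R3 × S2 → ℝ} (hb_meas : Measurable b) (hb_nonneg : ∀ p, 0 ≤ b p)
    (hb_int : Integrable b ((volume : Measure R3).prod sphMeasure))
    {f₀ : R3 × R3 → ℝ} {f g : ℝ × R3 × R3 → ℝ} (hf : Good f) (hg : Measurable g)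
    (hgb : ∀ᵐ p : ℝ × R3 × R3, 0 ≤ p.1 → 0 ≤ g p ∧ g p ≤ 1)
    (hfs : IsMildSolution b f₀ f) (hgs : IsMildSolution b f₀ g) :
    ∀ᵐ p : ℝ × R3 × R3, 0 ≤ p.1 → g p = f p := by
  have hl : 0 < lam b := by have := mass_nonneg hb_nonneg; unfold lam; linarith
  have key : ∀ n : ℕ, ∀ᵐ p : ℝ × R3 × R3, 0 ≤ p.1 →
      |g p - f p| ≤ (1 / 2) ^ n * Real.exp (lam b * p.1) := by
    intro n
    induction n with
    | zero =>
      filter_upwards [hgb] with p hp h0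
      have h1 := hp h0
      have h2 := hf.2 p h0
      have h3 : 1 ≤ Real.exp (lam b * p.1) := Real.one_le_exp (by positivity)
      rw [pow_zero, one_mul, abs_le]
      constructor <;> linarith
    | succ n ih =>
      classical
      set A : Set (ℝ × R3 × R3) := {p | |g p - f p| ≤ (1 / 2) ^ n * Real.exp (lam b * p.1)} ∩
        ({p | 0 ≤ g p} ∩ {p | g p ≤ 1}) with hA
      have hAm : MeasurableSet A := by
        have hf1 := hf.1
        refine (measurableSet_le ?_ ?_).inter ((measurableSet_le measurable_const hg).inter
          (measurableSet_le hg measurable_const))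
        · exact (hg.sub hf1).abs
        · fun_prop
      set g' : ℝ × R3 × R3 → ℝ := A.piecewise g f with hg'
      have hg'm : Measurable g' := Measurable.piecewise hAm hg hf.1
      have hg'good : Good g' := by
        refine ⟨hg'm, fun p hp => ?_⟩
        by_cases hpA : p ∈ A
        · rw [hg', Set.piecewise_eq_of_mem _ _ _ hpA]; exact hpA.2
        · rw [hg', Set.piecewise_eq_of_notMem _ _ _ hpA]; exact hf.2 p hp
      have hg'est : ∀ p : ℝ × R3 × R3, 0 ≤ p.1 →
          |g' p - f p| ≤ (1 / 2) ^ n * Real.exp (lam b * p.1) := by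
        intro p hp
        by_cases hpA : p ∈ A
        · rw [hg', Set.piecewise_eq_of_mem _ _ _ hpA]; exact hpA.1
        · rw [hg', Set.piecewise_eq_of_notMem _ _ _ hpA, sub_self, abs_zero]; positivity
      have hae : ∀ᵐ p : ℝ × R3 × R3, 0 ≤ p.1 → g p = g' p := by
        filter_upwards [ih, hgb] with p h1 h2 h0
        have hpA : p ∈ A := ⟨h1 h0, h2 h0⟩
        rw [hg', Set.piecewise_eq_of_mem _ _ _ hpA]
      have hQ := QF_congr_ae hb_meas hg hg'm hae
      have hS : MeasurableSet {p : ℝ × R3 × R3 | 0 ≤ p.1 →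
          |g p - f p| ≤ (1 / 2) ^ (n + 1) * Real.exp (lam b * p.1)} := by
        have e : {p : ℝ × R3 × R3 | 0 ≤ p.1 →
          |g p - f p| ≤ (1 / 2) ^ (n + 1) * Real.exp (lam b * p.1)} = {p | 0 ≤ p.1}ᶜ ∪
            {p | |g p - f p| ≤ (1 / 2) ^ (n + 1) * Real.exp (lam b * p.1)} := by
          ext p; exact imp_iff_not_or
        rw [e]
        refine (measurableSet_le measurable_const measurable_fst).compl.union
          (measurableSet_le ?_ ?_)
        · exact (hg.sub hf.1).abs
        · fun_prop
      refine (ae_char hS).2 ?_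
      filter_upwards [hQ, hfs, hgs] with q hq hf1 hg1
      refine Filter.Eventually.of_forall fun t ht => ?_
      have ht : 0 ≤ t := ht
      rw [hf1 t ht, hg1 t ht, add_sub_add_left_eq_sub]
      have e : (∫ s in (0 : ℝ)..t, Qcoll b (fun w => g (s, q.1 + s • q.2, w)) q.2) =
          ∫ s in (0 : ℝ)..t, QF b g' (s, q.1 + s • q.2, q.2) := by
        refine intervalIntegral.integral_congr_ae ?_
        filter_upwards [hq] with s hs hs'
        rw [Set.uIoc_of_le ht] at hs'
        exact hs hs'.1.le
      rw [e]
      refine (est hb_meas hb_nonneg hb_int hf hg'good (by positivity) hg'est q.1 q.2 ht).trans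
        (le_of_eq ?_)
      rw [pow_succ]; ring
  filter_upwards [ae_all_iff.2 key] with p hp h0
  have hlim : Filter.Tendsto (fun n : ℕ => (1 / 2 : ℝ) ^ n * Real.exp (lam b * p.1)) Filter.atTop
      (nhds 0) := by
    have := (tendsto_pow_atTop_nhds_zero_of_lt_one (r := (1 / 2 : ℝ)) (by norm_num)
      (by norm_num)).mul_const (Real.exp (lam b * p.1))
    rwa [zero_mul] at this
  have := ge_of_tendsto' hlim fun n => hp n h0
  exact sub_eq_zero.1 (abs_nonpos_iff.1 this)

/-- Existence and uniqueness of a mild solution of the Boltzmann–Fermi–Dirac equation: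
for an integrable collision kernel and an initial datum `0 ≤ f₀ ≤ 1`, there is a unique
(up to a.e. equality) measurable `f` with `0 ≤ f ≤ 1` a.e. which is a mild solution with
initial datum `f₀`; moreover, for a.e. `(x,v)` the map `t ↦ f(t, x + t v, v)` is
absolutely continuous. -/
theorem exists_unique_mild_solution
    (b : R3 × S2 → ℝ) (hb_meas : Measurable b) (hb_nonneg : ∀ p, 0 ≤ b p)
    (hb_int : Integrable b ((volume : Measure R3).prod sphMeasure))
    (f₀ : R3 × R3 → ℝ) (hf₀_meas : Measurable f₀)
    (hf₀_bd : ∀ᵐ q : R3 × R3 ∂(volume : Measure (R3 × R3)), 0 ≤ f₀ q ∧ f₀ q ≤ 1) :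
    ∃ f : ℝ × R3 × R3 → ℝ,
      (Measurable f ∧
        (∀ᵐ p ∂(volume : Measure (ℝ × R3 × R3)).restrict
            (Set.Ici (0 : ℝ) ×ˢ (Set.univ : Set (R3 × R3))), 0 ≤ f p ∧ f p ≤ 1) ∧
        IsMildSolution b f₀ f ∧
        (∀ᵐ q : R3 × R3 ∂(volume : Measure (R3 × R3)),
          AbsContOn (fun t => f (t, q.1 + t • q.2, q.2)) (Set.Ici 0))) ∧
      ∀ g : ℝ × R3 × R3 → ℝ, Measurable g →
        (∀ᵐ p ∂(volume : Measure (ℝ × R3 × R3)).restrict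
            (Set.Ici (0 : ℝ) ×ˢ (Set.univ : Set (R3 × R3))), 0 ≤ g p ∧ g p ≤ 1) →
        IsMildSolution b f₀ g →
        (∀ᵐ p ∂(volume : Measure (ℝ × R3 × R3)).restrict
            (Set.Ici (0 : ℝ) ×ˢ (Set.univ : Set (R3 × R3))), g p = f p) := by
  obtain ⟨f, hf, hfix⟩ := exists_fixed hb_meas hb_nonneg hb_int hf₀_meas
  have hsol := fun x v t (ht : (0 : ℝ) ≤ t) =>
    fixed_solves hb_meas hb_nonneg hb_int hf hfix x v ht
  have hmild : IsMildSolution b f₀ f := by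
    filter_upwards [hf₀_bd] with q hq t ht
    rw [hsol q.1 q.2 t ht, clip_of_mem hq.1 hq.2]
    rfl
  refine ⟨f, ⟨hf.1, ae_restrict_time.2 (Filter.Eventually.of_forall hf.2), hmild, ?_⟩, ?_⟩
  · refine Filter.Eventually.of_forall fun q ε hε => ?_
    have hB := mass_nonneg hb_nonneg
    refine ⟨ε / (mass b + 1), by positivity, fun n a c hac _ hsum => ?_⟩
    have h1 : ∀ i, |f (c i, q.1 + c i • q.2, q.2) - f (a i, q.1 + a i • q.2, q.2)| ≤
        mass b * (c i - a i) := by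
      intro i
      obtain ⟨ha, hc, hle⟩ := hac i
      rw [hsol _ _ _ ha, hsol _ _ _ hc, add_sub_add_left_eq_sub,
        intervalIntegral.integral_interval_sub_left
          (intble_char hb_meas hb_nonneg hb_int hf _ _ le_rfl hc)
          (intble_char hb_meas hb_nonneg hb_int hf _ _ le_rfl ha)]
      exact lip_char hb_nonneg hb_int hf _ _ ha hle
    have h2 : 0 ≤ ∑ i, (c i - a i) := Finset.sum_nonneg fun i _ => sub_nonneg.2 (hac i).2.2
    calc (∑ i, |f (c i, q.1 + c i • q.2, q.2) - f (a i, q.1 + a i • q.2, q.2)|)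
        ≤ ∑ i, mass b * (c i - a i) := Finset.sum_le_sum fun i _ => h1 i
      _ = mass b * ∑ i, (c i - a i) := by rw [Finset.mul_sum]
      _ ≤ (mass b + 1) * ∑ i, (c i - a i) := by gcongr; linarith
      _ < ε := by rw [lt_div_iff₀ (by positivity)] at hsum; linarith
  · intro g hg hgb hgs
    exact ae_restrict_time.2 (unique_aux hb_meas hb_nonneg hb_int hf hg (ae_restrict_time.1 hgb)
      hmild hgs)
end
end

section
/- Let θ > 0 and let f₀ be measurable with 0 ≤ f₀ ≤ 1 a.e. For f ∈ L^∞([0,θ] × ℝ³ × ℝ³) let f̄ = min(max(f,0),1) denote its truncation to [0,1], and define (T f)(t,x,v) = f₀(x - t v, v) + ∫₀ᵗ Q(f̄(s, x - (t-s) v, ·))(v) ds. Then for all f₁, f₂ ∈ L^∞([0,θ] × ℝ³ × ℝ³), ‖T f₁ - T f₂‖_{L^∞([0,θ]×ℝ³×ℝ³)} ≤ 8 B θ ‖f₁ - f₂‖_{L^∞([0,θ]×ℝ³×ℝ³)}; in particular T is a contraction whenever θ < 1/(8B). -/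
open MeasureTheory Metric
open scoped RealInnerProductSpace ENNReal

noncomputable section

/-- Truncation of a function to the interval `[0,1]`: `f̄ = min(max(f,0),1)`. -/
def trunc01 (f : ℝ × R3 × R3 → ℝ) (p : ℝ × R3 × R3) : ℝ := min (max (f p) 0) 1

/-- The fixed-point map of the existence proof:
`(T f)(t,x,v) = f₀(x - t v, v) + ∫₀ᵗ Q(f̄(s, x - (t-s) v, ·))(v) ds`. -/
def fixedPointMap (b : R3 × S2 → ℝ) (f₀ : R3 × R3 → ℝ) (f : ℝ × R3 × R3 → ℝ)
    (p : ℝ × R3 × R3) : ℝ :=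
  f₀ (p.2.1 - p.1 • p.2.2, p.2.2) +
    ∫ s in (0 : ℝ)..p.1,
      Qcoll b (fun w => trunc01 f (s, p.2.1 - (p.1 - s) • p.2.2, w)) p.2.2


/-- The bracket in the collision operator. -/
def Dbr (g : R3 → ℝ) (v : R3) (z : S2 × R3) : ℝ :=
  g (vPrime v z.2 z.1) * g (vsPrime v z.2 z.1) * (1 - g v) * (1 - g z.2)
          - g v * g z.2 * (1 - g (vPrime v z.2 z.1)) * (1 - g (vsPrime v z.2 z.1))

lemma vPrime_meas : Measurable (fun z : R3 × R3 × S2 => vPrime z.1 z.2.1 z.2.2) := by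
  unfold vPrime
  apply Continuous.measurable
  fun_prop

lemma vsPrime_meas : Measurable (fun z : R3 × R3 × S2 => vsPrime z.1 z.2.1 z.2.2) := by
  unfold vsPrime
  apply Continuous.measurable
  fun_prop

lemma prod_mem01 (a b : ℝ) (ha : 0 ≤ a ∧ a ≤ 1) (hb : 0 ≤ b ∧ b ≤ 1) : 0 ≤ a * b ∧ a * b ≤ 1 :=
  ⟨mul_nonneg ha.1 hb.1, mul_le_one₀ ha.2 hb.1 hb.2⟩

lemma prod_diff (a b a' b' m n : ℝ) (ha : 0 ≤ a ∧ a ≤ 1) (hb : 0 ≤ b' ∧ b' ≤ 1)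
    (h1 : |a - a'| ≤ m) (h2 : |b - b'| ≤ n) : |a * b - a' * b'| ≤ m + n := by
  have : a * b - a' * b' = a * (b - b') + (a - a') * b' := by ring
  rw [this]
  refine (abs_add_le _ _).trans ?_
  rw [abs_mul, abs_mul, abs_of_nonneg ha.1, abs_of_nonneg hb.1]
  nlinarith [abs_nonneg (a - a'), abs_nonneg (b - b'), ha.1, ha.2, hb.1, hb.2]

lemma prod4_diff (a b c d a' b' c' d' m : ℝ)
    (ha : 0 ≤ a ∧ a ≤ 1) (hb : 0 ≤ b ∧ b ≤ 1) (hc : 0 ≤ c ∧ c ≤ 1)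
    (hb' : 0 ≤ b' ∧ b' ≤ 1) (hc' : 0 ≤ c' ∧ c' ≤ 1) (hd' : 0 ≤ d' ∧ d' ≤ 1)
    (h1 : |a - a'| ≤ m) (h2 : |b - b'| ≤ m) (h3 : |c - c'| ≤ m) (h4 : |d - d'| ≤ m) :
    |a * b * c * d - a' * b' * c' * d'| ≤ 4 * m := by
  have e1 := prod_diff a b a' b' m m ha hb' h1 h2
  have e2 := prod_diff _ c _ c' _ m (prod_mem01 _ _ ha hb) hc' e1 h3
  have e3 := prod_diff _ d _ d' _ m (prod_mem01 _ _ (prod_mem01 _ _ ha hb) hc) hd' e2 h4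
  linarith

lemma one_sub_mem {a : ℝ} (ha : 0 ≤ a ∧ a ≤ 1) : 0 ≤ 1 - a ∧ 1 - a ≤ 1 :=
  ⟨by linarith [ha.2], by linarith [ha.1]⟩

lemma Dbr_bound (g : R3 → ℝ) (hg : ∀ w, 0 ≤ g w ∧ g w ≤ 1) (v : R3) (z : S2 × R3) :
    |Dbr g v z| ≤ 1 := by
  unfold Dbr
  have h1 := hg v
  have h2 := hg z.2
  have h3 := hg (vPrime v z.2 z.1)
  have h4 := hg (vsPrime v z.2 z.1)
  have k1 := prod_mem01 _ _ (prod_mem01 _ _ (prod_mem01 _ _ h3 h4) (one_sub_mem h1)) (one_sub_mem h2)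
  have k2 := prod_mem01 _ _ (prod_mem01 _ _ (prod_mem01 _ _ h1 h2) (one_sub_mem h3)) (one_sub_mem h4)
  rw [abs_le]
  constructor <;> linarith [k1.1, k1.2, k2.1, k2.2]

lemma Dbr_diff (g h : R3 → ℝ) (hg : ∀ w, 0 ≤ g w ∧ g w ≤ 1) (hh : ∀ w, 0 ≤ h w ∧ h w ≤ 1)
    (v : R3) (z : S2 × R3) (m : ℝ) (h1 : |g v - h v| ≤ m) (h2 : |g z.2 - h z.2| ≤ m)
    (h3 : |g (vPrime v z.2 z.1) - h (vPrime v z.2 z.1)| ≤ m)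
    (h4 : |g (vsPrime v z.2 z.1) - h (vsPrime v z.2 z.1)| ≤ m) :
    |Dbr g v z - Dbr h v z| ≤ 8 * m := by
  unfold Dbr
  have flip : ∀ a b : ℝ, |a - b| ≤ m → |(1 - a) - (1 - b)| ≤ m := by
    intro a b hab
    rw [abs_sub_comm] at hab
    convert hab using 2
    ring
  have k1 := prod4_diff _ _ _ _ _ _ _ _ m (hg (vPrime v z.2 z.1)) (hg (vsPrime v z.2 z.1))
    (one_sub_mem (hg v)) (hh (vsPrime v z.2 z.1)) (one_sub_mem (hh v)) (one_sub_mem (hh z.2))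
    h3 h4 (flip _ _ h1) (flip _ _ h2)
  have k2 := prod4_diff _ _ _ _ _ _ _ _ m (hg v) (hg z.2)
    (one_sub_mem (hg (vPrime v z.2 z.1))) (hh z.2) (one_sub_mem (hh (vPrime v z.2 z.1)))
    (one_sub_mem (hh (vsPrime v z.2 z.1)))
    h1 h2 (flip _ _ h3) (flip _ _ h4)
  rw [abs_le] at *
  constructor <;> linarith [k1.1, k1.2, k2.1, k2.2]

lemma Dbr_meas {α : Type*} [MeasurableSpace α] (g : α → R3 → ℝ)
    (hg : Measurable (fun q : α × R3 => g q.1 q.2)) (v : R3) :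
    Measurable (fun q : α × (S2 × R3) => Dbr (g q.1) v q.2) := by
  unfold Dbr
  have m3 : Measurable (fun q : α × (S2 × R3) => vPrime v q.2.2 q.2.1) :=
    vPrime_meas.comp (measurable_const.prodMk
      ((measurable_snd.comp measurable_snd).prodMk (measurable_fst.comp measurable_snd)))
  have m4 : Measurable (fun q : α × (S2 × R3) => vsPrime v q.2.2 q.2.1) :=
    vsPrime_meas.comp (measurable_const.prodMk
      ((measurable_snd.comp measurable_snd).prodMk (measurable_fst.comp measurable_snd)))
  have k1 : Measurable (fun q : α × (S2 × R3) => g q.1 v) :=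
    hg.comp (measurable_fst.prodMk measurable_const)
  have k2 : Measurable (fun q : α × (S2 × R3) => g q.1 q.2.2) :=
    hg.comp (measurable_fst.prodMk (measurable_snd.comp measurable_snd))
  have k3 : Measurable (fun q : α × (S2 × R3) => g q.1 (vPrime v q.2.2 q.2.1)) :=
    hg.comp (measurable_fst.prodMk m3)
  have k4 : Measurable (fun q : α × (S2 × R3) => g q.1 (vsPrime v q.2.2 q.2.1)) :=
    hg.comp (measurable_fst.prodMk m4)
  exact (((k3.mul k4).mul (k1.const_sub 1)).mul (k2.const_sub 1)).sub
    (((k1.mul k2).mul (k3.const_sub 1)).mul (k4.const_sub 1))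

section Q
variable (b : R3 × S2 → ℝ) 

lemma mp_sub (v : R3) : MeasurePreserving (fun z : S2 × R3 => (z.1, v - z.2))
    (sphMeasure.prod (volume : Measure R3)) (sphMeasure.prod (volume : Measure R3)) :=
  (MeasurePreserving.id sphMeasure).prod (Measure.measurePreserving_sub_left volume v)

lemma b_int (hb_int : Integrable b ((volume : Measure R3).prod sphMeasure)) (v : R3) :
    Integrable (fun z : S2 × R3 => b (v - z.2, z.1)) (sphMeasure.prod (volume : Measure R3)) :=
  (mp_sub v).integrable_comp_of_integrable hb_int.swap

lemma b_integral (hb_meas : Measurable b) (v : R3) :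
    ∫ z : S2 × R3, b (v - z.2, z.1) ∂(sphMeasure.prod (volume : Measure R3)) =
     ∫ p, b p ∂((volume : Measure R3).prod sphMeasure) := by
  have h := integral_prod_swap (μ := (volume : Measure R3)) (ν := sphMeasure) b
  have h2 := integral_map (μ := sphMeasure.prod (volume : Measure R3)) (mp_sub v).measurable.aemeasurable
    (f := fun z : S2 × R3 => b z.swap) (hb_meas.comp measurable_swap).aestronglyMeasurable
  rw [(mp_sub v).map_eq] at h2
  rw [← h, h2]
  rfl

lemma bD_int (hb_meas : Measurable b)
    (hb_int : Integrable b ((volume : Measure R3).prod sphMeasure)) (v : R3)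
    (g : R3 → ℝ) (hgm : Measurable g) (hg : ∀ w, 0 ≤ g w ∧ g w ≤ 1) :
    Integrable (fun z : S2 × R3 => b (v - z.2, z.1) * Dbr g v z)
      (sphMeasure.prod (volume : Measure R3)) := by
  refine (b_int b hb_int v).mul_bdd (c := 1) ?_ ?_
  · have := (Dbr_meas (α := Unit) (fun _ => g) (hgm.comp measurable_snd) v).comp
      (measurable_const (a := ()) |>.prodMk measurable_id)
    exact this.aestronglyMeasurable
  · exact Filter.Eventually.of_forall fun z => Dbr_bound g hg v z

lemma Q_eq (hb_meas : Measurable b)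
    (hb_int : Integrable b ((volume : Measure R3).prod sphMeasure)) (v : R3)
    (g : R3 → ℝ) (hgm : Measurable g) (hg : ∀ w, 0 ≤ g w ∧ g w ≤ 1) :
    Qcoll b g v = ∫ z : S2 × R3, b (v - z.2, z.1) * Dbr g v z
      ∂(sphMeasure.prod (volume : Measure R3)) := by
  rw [integral_prod _ (bD_int b hb_meas hb_int v g hgm hg)]
  rfl

lemma Q_bound (hb_meas : Measurable b) (hb_nonneg : ∀ p, 0 ≤ b p)
    (hb_int : Integrable b ((volume : Measure R3).prod sphMeasure)) (v : R3)
    (g : R3 → ℝ) (hgm : Measurable g) (hg : ∀ w, 0 ≤ g w ∧ g w ≤ 1) :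
    |Qcoll b g v| ≤ ∫ p, b p ∂((volume : Measure R3).prod sphMeasure) := by
  rw [Q_eq b hb_meas hb_int v g hgm hg, ← b_integral b hb_meas v, ← Real.norm_eq_abs]
  refine norm_integral_le_of_norm_le (b_int b hb_int v) (Filter.Eventually.of_forall fun z => ?_)
  rw [norm_mul, Real.norm_of_nonneg (hb_nonneg _)]
  exact mul_le_of_le_one_right (hb_nonneg _) (Dbr_bound g hg v z)

lemma Q_diff (hb_meas : Measurable b) (hb_nonneg : ∀ p, 0 ≤ b p)
    (hb_int : Integrable b ((volume : Measure R3).prod sphMeasure)) (v : R3)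
    (g h : R3 → ℝ) (hgm : Measurable g) (hg : ∀ w, 0 ≤ g w ∧ g w ≤ 1)
    (hhm : Measurable h) (hh : ∀ w, 0 ≤ h w ∧ h w ≤ 1) (m : ℝ)
    (hd : ∀ᵐ z ∂(sphMeasure.prod (volume : Measure R3)), |Dbr g v z - Dbr h v z| ≤ m) :
    |Qcoll b g v - Qcoll b h v| ≤ (∫ p, b p ∂((volume : Measure R3).prod sphMeasure)) * m := by
  rw [Q_eq b hb_meas hb_int v g hgm hg, Q_eq b hb_meas hb_int v h hhm hh,
    ← integral_sub (bD_int b hb_meas hb_int v g hgm hg) (bD_int b hb_meas hb_int v h hhm hh),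
    ← b_integral b hb_meas v, ← Real.norm_eq_abs, ← integral_mul_const]
  refine norm_integral_le_of_norm_le ((b_int b hb_int v).mul_const m) (hd.mono fun z hz => ?_)
  rw [← mul_sub, norm_mul, Real.norm_of_nonneg (hb_nonneg _)]
  exact mul_le_mul_of_nonneg_left hz (hb_nonneg _)

end Q

lemma trunc_mem (f : ℝ × R3 × R3 → ℝ) (p) : 0 ≤ trunc01 f p ∧ trunc01 f p ≤ 1 := by
  unfold trunc01
  exact ⟨le_min (le_max_right _ _) zero_le_one, min_le_right _ _⟩

lemma trunc_meas {f : ℝ × R3 × R3 → ℝ} (hf : Measurable f) : Measurable (trunc01 f) := by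
  unfold trunc01
  exact (hf.max measurable_const).min measurable_const

lemma trunc_diff (f g : ℝ × R3 × R3 → ℝ) (p) : |trunc01 f p - trunc01 g p| ≤ |f p - g p| := by
  unfold trunc01
  refine (abs_min_sub_min_le_max _ _ _ _).trans ?_
  rw [sub_self, abs_zero, max_eq_left (abs_nonneg _)]
  refine (abs_max_sub_max_le_max _ _ _ _).trans ?_
  rw [sub_self, abs_zero, max_eq_left (abs_nonneg _)]

lemma Qint (b : R3 × S2 → ℝ) (hb_meas : Measurable b) (hb_nonneg : ∀ p, 0 ≤ b p)
    (hb_int : Integrable b ((volume : Measure R3).prod sphMeasure))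
    (f : ℝ × R3 × R3 → ℝ) (hf : Measurable f) (t : ℝ) (x v : R3) :
    IntervalIntegrable (fun s => Qcoll b (fun w => trunc01 f (s, x - (t - s) • v, w)) v)
      volume 0 t := by
  have hF : Measurable (fun q : ℝ × R3 => trunc01 f (q.1, x - (t - q.1) • v, q.2)) := by
    apply (trunc_meas hf).comp
    fun_prop
  have hm : ∀ s, Measurable (fun w => trunc01 f (s, x - (t - s) • v, w)) := fun s =>
    hF.comp (measurable_const.prodMk measurable_id)
  have hE : (fun s => Qcoll b (fun w => trunc01 f (s, x - (t - s) • v, w)) v) =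
     fun s => ∫ z : S2 × R3, b (v - z.2, z.1) *
      Dbr (fun w => trunc01 f (s, x - (t - s) • v, w)) v z
      ∂(sphMeasure.prod (volume : Measure R3)) := by
    funext s
    exact Q_eq b hb_meas hb_int v _ (hm s) (fun w => trunc_mem _ _)
  have hM : StronglyMeasurable
      (fun s => Qcoll b (fun w => trunc01 f (s, x - (t - s) • v, w)) v) := by
    rw [hE]
    apply StronglyMeasurable.integral_prod_right
      (f := fun s z => b (v - z.2, z.1) * Dbr (fun w => trunc01 f (s, x - (t - s) • v, w)) v z)
    apply Measurable.stronglyMeasurable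
    refine Measurable.mul (f := fun q : ℝ × (S2 × R3) => b (v - q.2.2, q.2.1)) ?_ ?_
    · apply hb_meas.comp
      fun_prop
    · exact Dbr_meas (fun s w => trunc01 f (s, x - (t - s) • v, w)) hF v
  refine (intervalIntegrable_const (c := ∫ p, b p ∂((volume : Measure R3).prod sphMeasure))).mono_fun
    hM.aestronglyMeasurable (Filter.Eventually.of_forall fun s => ?_)
  rw [Real.norm_eq_abs]
  exact (Q_bound b hb_meas hb_nonneg hb_int v _ (hm s) (fun w => trunc_mem _ _)).trans
    (le_abs_self _)

/-- A linear surjection transports a.e. statements in the position-velocity variables. -/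
lemma ae_lin (G : Set (R3 × R3)) (hG : MeasurableSet G) (hae : ∀ᵐ q : R3 × R3, q ∈ G)
    (L : ((R3 × R3) × R3) →ₗ[ℝ] (R3 × R3)) (hL : Function.Surjective L) :
    ∀ᵐ q : (R3 × R3) × R3, L q ∈ G := by
  have h1 : (volume : Measure (R3 × R3)).IsAddHaarMeasure :=
    inferInstanceAs (Measure.prod (volume : Measure R3) (volume : Measure R3)).IsAddHaarMeasure
  have h2 : (volume : Measure ((R3 × R3) × R3)).IsAddHaarMeasure :=
    Measure.prod.instIsAddHaarMeasure (volume : Measure (R3 × R3)) (volume : Measure R3)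
  exact (ae_comp_linearMap_mem_iff L volume volume hL hG).2 hae

lemma ae_main (G : Set (ℝ × R3 × R3)) (hG : MeasurableSet G) (hae : ∀ᵐ p, p ∈ G)
    (φ : R3 → R3 → S2 → R3) (hφ : Measurable (fun z : R3 × R3 × S2 => φ z.1 z.2.1 z.2.2))
    (hL : ∀ ω, ∃ L : R3 × R3 →ₗ[ℝ] R3, (∀ v vs, φ v vs ω = L (v, vs)) ∧ Function.Surjective L) :
    ∀ᵐ p : ℝ × R3 × R3, ∀ᵐ s : ℝ, ∀ᵐ z ∂(sphMeasure.prod (volume : Measure R3)),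
      (s, p.2.1 - (p.1 - s) • p.2.2, φ p.2.2 z.2 z.1) ∈ G := by
  -- the joint set
  have hmap : Measurable (fun q : ((ℝ × R3 × R3) × (ℝ × S2)) × R3 =>
      (q.1.2.1, q.1.1.2.1 - (q.1.1.1 - q.1.2.1) • q.1.1.2.2, φ q.1.1.2.2 q.2 q.1.2.2)) := by
    refine Measurable.prodMk (by fun_prop) (Measurable.prodMk (by fun_prop) ?_)
    exact hφ.comp (by fun_prop :
      Measurable (fun q : ((ℝ × R3 × R3) × (ℝ × S2)) × R3 => (q.1.1.2.2, q.2, q.1.2.2)))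
  have hA : MeasurableSet {q : ((ℝ × R3 × R3) × (ℝ × S2)) × R3 |
      (q.1.2.1, q.1.1.2.1 - (q.1.1.1 - q.1.2.1) • q.1.1.2.2, φ q.1.1.2.2 q.2 q.1.2.2) ∈ G} :=
    hmap hG
  have hA2 : MeasurableSet {q : (ℝ × R3 × R3) × (ℝ × S2) | ∀ᵐ vs : R3,
      (q.2.1, q.1.2.1 - (q.1.1 - q.2.1) • q.1.2.2, φ q.1.2.2 vs q.2.2) ∈ G} := by
    have := measurable_measure_prodMk_left (ν := (volume : Measure R3)) hA.compl
    exact this (measurableSet_singleton 0)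
  have hs : ∀ᵐ s : ℝ, ∀ᵐ q : R3 × R3, (s, q) ∈ G := Measure.ae_ae_of_ae_prod hae
  have key : ∀ᵐ q ∂((volume : Measure ℝ).prod sphMeasure), ∀ᵐ p : ℝ × R3 × R3, ∀ᵐ vs : R3,
      (q.1, p.2.1 - (p.1 - q.1) • p.2.2, φ p.2.2 vs q.2) ∈ G := by
    have hs' : ∀ᵐ q ∂((volume : Measure ℝ).prod sphMeasure), ∀ᵐ r : R3 × R3, (q.1, r) ∈ G :=
      Measure.quasiMeasurePreserving_fst.ae hs
    refine hs'.mono fun q hq => ?_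
    refine (Measure.ae_prod_iff_ae_ae (μ := (volume : Measure ℝ))
      (ν := (volume : Measure (R3 × R3)))
      (p := fun p => ∀ᵐ vs : R3, (q.1, p.2.1 - (p.1 - q.1) • p.2.2, φ p.2.2 vs q.2) ∈ G) ?_).2 ?_
    · exact (measurable_prodMk_right (y := q)) hA2
    refine Filter.Eventually.of_forall fun t => ?_
    obtain ⟨L, hL1, hL2⟩ := hL q.2
    let X : ((R3 × R3) × R3) →ₗ[ℝ] R3 := LinearMap.fst ℝ R3 R3 ∘ₗ LinearMap.fst ℝ (R3 × R3) R3
    let V : ((R3 × R3) × R3) →ₗ[ℝ] R3 := LinearMap.snd ℝ R3 R3 ∘ₗ LinearMap.fst ℝ (R3 × R3) R3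
    let W : ((R3 × R3) × R3) →ₗ[ℝ] R3 := LinearMap.snd ℝ (R3 × R3) R3
    let K : ((R3 × R3) × R3) →ₗ[ℝ] (R3 × R3) := (X - (t - q.1) • V).prod (L ∘ₗ (V.prod W))
    have hK : ∀ r, K r = (r.1.1 - (t - q.1) • r.1.2, φ r.1.2 r.2 q.2) := by
      intro r
      rw [hL1]
      rfl
    have hKs : Function.Surjective K := by
      rintro ⟨y, w⟩
      obtain ⟨⟨v, vs⟩, h⟩ := hL2 w
      refine ⟨((y + (t - q.1) • v, v), vs), ?_⟩
      rw [hK, hL1]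
      simp [h]
    have h := ae_lin {r | (q.1, r) ∈ G} (measurable_prodMk_left hG) hq K hKs
    have h' := Measure.ae_ae_of_ae_prod (μ := (volume : Measure (R3 × R3)))
      (ν := (volume : Measure R3)) h
    filter_upwards [h'] with r hr
    filter_upwards [hr] with vs hvs
    rw [hK] at hvs
    exact hvs
  have key2 := (Measure.ae_ae_comm (μ := (volume : Measure (ℝ × R3 × R3)))
    (ν := (volume : Measure ℝ).prod sphMeasure) (p := fun p q => ∀ᵐ vs : R3,
      (q.1, p.2.1 - (p.1 - q.1) • p.2.2, φ p.2.2 vs q.2) ∈ G) hA2).2 key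
  filter_upwards [key2] with p hp
  filter_upwards [Measure.ae_ae_of_ae_prod hp] with s hs2
  refine (Measure.ae_prod_iff_ae_ae ?_).2 hs2
  have hm : Measurable (fun z : S2 × R3 => ((p, (s, z.1)), z.2)) := by fun_prop
  exact hm hA

lemma sphere_norm (ω : S2) : ⟪(ω : R3), (ω : R3)⟫ = 1 := by
  rw [real_inner_self_eq_norm_sq]
  simp

lemma invol1 (v vs : R3) (ω : S2) :
    vPrime (vPrime v vs ω) (vsPrime v vs ω) ω = v := by
  have h := sphere_norm ω
  unfold vPrime vsPrime
  simp only [inner_sub_left, inner_add_left, inner_smul_left, h]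
  simp only [RCLike.conj_to_real, mul_one]
  module

lemma invol2 (v vs : R3) (ω : S2) :
    vsPrime (vPrime v vs ω) (vsPrime v vs ω) ω = vs := by
  have h := sphere_norm ω
  unfold vPrime vsPrime
  simp only [inner_sub_left, inner_add_left, inner_smul_left, h]
  simp only [RCLike.conj_to_real, mul_one]
  module

lemma vPrime_lin (ω : S2) : ∃ L : R3 × R3 →ₗ[ℝ] R3,
    (∀ v vs, vPrime v vs ω = L (v, vs)) ∧ Function.Surjective L := by
  let L : R3 × R3 →ₗ[ℝ] R3 :=
    { toFun := fun q => vPrime q.1 q.2 ω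
      map_add' := by
        intro p q
        simp only [vPrime, Prod.fst_add, Prod.snd_add, inner_sub_left, inner_add_left]
        module
      map_smul' := by
        intro c q
        simp only [vPrime, Prod.smul_fst, Prod.smul_snd, inner_sub_left, inner_smul_left,
          RCLike.conj_to_real, RingHom.id_apply]
        module }
  exact ⟨L, fun _ _ => rfl, fun w => ⟨(vPrime w 0 ω, vsPrime w 0 ω), invol1 w 0 ω⟩⟩

lemma vsPrime_lin (ω : S2) : ∃ L : R3 × R3 →ₗ[ℝ] R3,
    (∀ v vs, vsPrime v vs ω = L (v, vs)) ∧ Function.Surjective L := by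
  let L : R3 × R3 →ₗ[ℝ] R3 :=
    { toFun := fun q => vsPrime q.1 q.2 ω
      map_add' := by
        intro p q
        simp only [vsPrime, Prod.fst_add, Prod.snd_add, inner_sub_left, inner_add_left]
        module
      map_smul' := by
        intro c q
        simp only [vsPrime, Prod.smul_fst, Prod.smul_snd, inner_sub_left, inner_smul_left,
          RCLike.conj_to_real, RingHom.id_apply]
        module }
  exact ⟨L, fun _ _ => rfl, fun w => ⟨(vPrime 0 w ω, vsPrime 0 w ω), invol2 0 w ω⟩⟩

/-- The fixed-point map `T` satisfies
`‖T f₁ - T f₂‖_{L^∞([0,θ]×ℝ³×ℝ³)} ≤ 8 B θ ‖f₁ - f₂‖_{L^∞([0,θ]×ℝ³×ℝ³)}`;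
in particular it is a contraction whenever `θ < 1/(8B)`. -/
theorem fixedPointMap_contraction
    (b : R3 × S2 → ℝ) (hb_meas : Measurable b) (hb_nonneg : ∀ p, 0 ≤ b p)
    (hb_int : Integrable b ((volume : Measure R3).prod sphMeasure))
    (B : ℝ) (hB : B = ∫ p, b p ∂((volume : Measure R3).prod sphMeasure))
    (θ : ℝ) (hθ : 0 < θ)
    (f₀ : R3 × R3 → ℝ) (hf₀_meas : Measurable f₀)
    (hf₀_bd : ∀ᵐ q : R3 × R3 ∂(volume : Measure (R3 × R3)), 0 ≤ f₀ q ∧ f₀ q ≤ 1)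
    (f₁ f₂ : ℝ × R3 × R3 → ℝ) (hf₁_meas : Measurable f₁) (hf₂_meas : Measurable f₂)
    (hf₁_bd : eLpNorm f₁ ⊤ ((volume : Measure (ℝ × R3 × R3)).restrict
        (Set.Icc 0 θ ×ˢ (Set.univ : Set (R3 × R3)))) < ⊤)
    (hf₂_bd : eLpNorm f₂ ⊤ ((volume : Measure (ℝ × R3 × R3)).restrict
        (Set.Icc 0 θ ×ˢ (Set.univ : Set (R3 × R3)))) < ⊤) :
    eLpNorm (fun p => fixedPointMap b f₀ f₁ p - fixedPointMap b f₀ f₂ p) ⊤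
        ((volume : Measure (ℝ × R3 × R3)).restrict
          (Set.Icc 0 θ ×ˢ (Set.univ : Set (R3 × R3)))) ≤
      ENNReal.ofReal (8 * B * θ) *
        eLpNorm (fun p => f₁ p - f₂ p) ⊤
          ((volume : Measure (ℝ × R3 × R3)).restrict
            (Set.Icc 0 θ ×ˢ (Set.univ : Set (R3 × R3)))) := by
  have hBnn : 0 ≤ B := by rw [hB]; exact integral_nonneg hb_nonneg
  set μ := (volume : Measure (ℝ × R3 × R3)).restrict
    (Set.Icc 0 θ ×ˢ (Set.univ : Set (R3 × R3))) with hμ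
  have hset : MeasurableSet (Set.Icc 0 θ ×ˢ (Set.univ : Set (R3 × R3))) :=
    measurableSet_Icc.prod MeasurableSet.univ
  have hfin : eLpNorm (fun p => f₁ p - f₂ p) ⊤ μ < ⊤ := by
    have m1 : MemLp f₁ ⊤ μ := ⟨hf₁_meas.aestronglyMeasurable, hf₁_bd⟩
    have m2 : MemLp f₂ ⊤ μ := ⟨hf₂_meas.aestronglyMeasurable, hf₂_bd⟩
    exact (m1.sub m2).2
  set N := eLpNorm (fun p => f₁ p - f₂ p) ⊤ μ with hN
  set M := N.toReal with hM
  have hMnn : 0 ≤ M := ENNReal.toReal_nonneg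
  have hNM : N = ENNReal.ofReal M := (ENNReal.ofReal_toReal hfin.ne).symm
  let G : Set (ℝ × R3 × R3) := {p | p.1 ∈ Set.Icc 0 θ → |f₁ p - f₂ p| ≤ M}
  have hG : MeasurableSet G := by
    have h1 : MeasurableSet {p : ℝ × R3 × R3 | p.1 ∈ Set.Icc 0 θ} :=
      measurable_fst measurableSet_Icc
    have h2 : MeasurableSet {p : ℝ × R3 × R3 | |f₁ p - f₂ p| ≤ M} :=
      measurableSet_le (by simpa [Real.norm_eq_abs] using (hf₁_meas.sub hf₂_meas).norm)
        measurable_const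
    exact h1.imp h2
  have hae : ∀ᵐ p, p ∈ G := by
    have h := ae_le_eLpNormEssSup (f := fun p => f₁ p - f₂ p) (μ := μ)
    rw [← eLpNorm_exponent_top, ← hN, hμ, ae_restrict_iff' hset] at h
    filter_upwards [h] with p hp hp1
    have h3 := hp ⟨hp1, Set.mem_univ _⟩
    rw [hNM, ← ofReal_norm, ENNReal.ofReal_le_ofReal_iff hMnn] at h3
    exact h3
  have a1 := ae_main G hG hae (fun v _ _ => v) measurable_fst
    (fun _ => ⟨LinearMap.fst ℝ R3 R3, fun _ _ => rfl, LinearMap.fst_surjective⟩)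
  have a2 := ae_main G hG hae (fun _ vs _ => vs) (by fun_prop)
    (fun _ => ⟨LinearMap.snd ℝ R3 R3, fun _ _ => rfl, LinearMap.snd_surjective⟩)
  have a3 := ae_main G hG hae vPrime vPrime_meas vPrime_lin
  have a4 := ae_main G hG hae vsPrime vsPrime_meas vsPrime_lin
  have hfinal : ∀ᵐ p ∂μ, ‖fixedPointMap b f₀ f₁ p - fixedPointMap b f₀ f₂ p‖ ≤
      8 * B * θ * M := by
    rw [hμ, ae_restrict_iff' hset]
    filter_upwards [a1, a2, a3, a4] with p h1 h2 h3 h4 hp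
    obtain ⟨t, x, v⟩ := p
    have ht : t ∈ Set.Icc 0 θ := hp.1
    simp only [fixedPointMap]
    simp only at h1 h2 h3 h4
    rw [add_sub_add_left_eq_sub, ← intervalIntegral.integral_sub
      (Qint b hb_meas hb_nonneg hb_int f₁ hf₁_meas t x v)
      (Qint b hb_meas hb_nonneg hb_int f₂ hf₂_meas t x v)]
    have hbd := intervalIntegral.norm_integral_le_of_norm_le_const_ae (a := 0) (b := t)
      (C := B * (8 * M)) (f := fun s =>
        Qcoll b (fun w => trunc01 f₁ (s, x - (t - s) • v, w)) v -
        Qcoll b (fun w => trunc01 f₂ (s, x - (t - s) • v, w)) v) ?_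
    · refine hbd.trans ?_
      rw [sub_zero, abs_of_nonneg ht.1]
      have : B * (8 * M) * t ≤ B * (8 * M) * θ :=
        mul_le_mul_of_nonneg_left ht.2 (by positivity)
      linarith
    · filter_upwards [h1, h2, h3, h4] with s k1 k2 k3 k4 hs
      rw [Set.uIoc_of_le ht.1] at hs
      have hsI : s ∈ Set.Icc 0 θ := ⟨hs.1.le, hs.2.trans ht.2⟩
      have hm : ∀ f : ℝ × R3 × R3 → ℝ, Measurable f →
          Measurable (fun w => trunc01 f (s, x - (t - s) • v, w)) := fun f hf =>
        (trunc_meas hf).comp (by fun_prop)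
      rw [Real.norm_eq_abs, hB]
      refine Q_diff b hb_meas hb_nonneg hb_int v _ _ (hm f₁ hf₁_meas) (fun w => trunc_mem _ _)
        (hm f₂ hf₂_meas) (fun w => trunc_mem _ _) (8 * M) ?_
      filter_upwards [k1, k2, k3, k4] with z l1 l2 l3 l4
      exact Dbr_diff _ _ (fun w => trunc_mem _ _) (fun w => trunc_mem _ _) v z M
        ((trunc_diff _ _ _).trans (l1 hsI)) ((trunc_diff _ _ _).trans (l2 hsI))
        ((trunc_diff _ _ _).trans (l3 hsI)) ((trunc_diff _ _ _).trans (l4 hsI))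
  rw [hNM, ← ENNReal.ofReal_mul (by positivity), eLpNorm_exponent_top]
  exact eLpNormEssSup_le_of_ae_bound hfinal
end
end
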